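/- arXiv:1606.01921 — 7 statements merged into one kernel-verified Lean document; each statement's English description precedes it below -/
import Mathlib

section
/- Let R be a perfect commutative ring of characteristic p. The ring W(R) of p-typical Witt vectors of R is p-adically complete and separated, p is a nonzerodivisor in W(R), and W(R)/pW(R) ≅ R. Moreover W(R) is the unique such ring up to isomorphism: if A is any commutative ring which is p-adically complete and separated, in which p is a nonzerodivisor, and which admits a ring isomorphism A/pA ≅ R, then A is isomorphic to W(R). -/
namespace Perfection

/-- The zeroth coefficient of the perfection of a ring with injective Frobenius determines the
whole sequence. -/
theorem coeff_zero_injective {p : ℕ} [Fact p.Prime] {S : Type*} [CommRing S] [CharP S p]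
    (h : Function.Injective (frobenius S p)) :
    Function.Injective (Perfection.coeff S p 0) := by
  intro x y hxy
  ext n
  induction n with
  | zero => exact hxy
  | succ n ih =>
    apply h
    simpa only [frobenius_def, coeff_pow_p'] using ih

end Perfection

namespace WittVector

variable {p : ℕ} [Fact p.Prime]

/-- A ring isomorphism induces an isomorphism on Witt vectors. -/
noncomputable def ringEquivOfRingEquiv {S T : Type*} [CommRing S] [CommRing T] (e : S ≃+* T) :
    WittVector p S ≃+* WittVector p T :=
  RingEquiv.ofBijective (WittVector.map (e : S →+* T))
    ⟨map_injective _ e.injective, map_surjective _ e.surjective⟩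

variable {A : Type*} [CommRing A] [Fact ¬IsUnit (p : A)] [IsAdicComplete (Ideal.span {(p : A)}) A]

/-- If `p` is a nonzerodivisor of `A` and the Frobenius of `A ⧸ p` is injective, then Fontaine's
map `θ` is injective. -/
theorem fontaineTheta_injective (hp : (p : A) ∈ nonZeroDivisors A)
    (hF : Function.Injective (_root_.frobenius (ModP A p) p)) :
    Function.Injective (fontaineTheta A p) := by
  have dvd_of_theta_eq_zero (x : WittVector p (PreTilt A p)) (hx : fontaineTheta A p x = 0) :
      ∃ y, x = p * y ∧ fontaineTheta A p y = 0 := by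
    have hc : x.coeff 0 = 0 := by
      have h : PreTilt.coeff 0 (x.coeff 0) = (0 : ModP A p) := by
        rw [← mk_fontaineTheta, hx, map_zero]
      exact Perfection.coeff_zero_injective hF (h.trans (map_zero (PreTilt.coeff 0)).symm)
    obtain ⟨y, rfl⟩ := Ideal.mem_span_singleton.mp
      ((mem_span_p_iff_coeff_zero_eq_zero x).mpr hc)
    refine ⟨y, rfl, ?_⟩
    rw [map_mul, map_natCast] at hx
    exact (mul_left_mem_nonZeroDivisors_eq_zero_iff hp).mp hx
  have pow_dvd (n : ℕ) : ∀ x : WittVector p (PreTilt A p), fontaineTheta A p x = 0 →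
      (p : WittVector p (PreTilt A p)) ^ n ∣ x := by
    induction n with
    | zero => simp
    | succ n ih =>
      intro x hx
      obtain ⟨y, rfl, hy⟩ := dvd_of_theta_eq_zero x hx
      rw [pow_succ']
      exact mul_dvd_mul_left _ (ih y hy)
  rw [injective_iff_map_eq_zero]
  intro x hx
  ext n
  rw [zero_coeff]
  exact (mem_span_p_pow_iff_le_coeff_eq_zero x (n + 1)).mp
    (Ideal.mem_span_singleton.mpr (pow_dvd (n + 1) x hx)) n n.lt_succ_self

/-- A `p`-adically complete ring `A` in which `p` is a nonzerodivisor and whose reduction mod `p`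
is perfect is isomorphic to the Witt vectors of its reduction. -/
theorem nonempty_ringEquiv_of_bijective_frobenius (hp : (p : A) ∈ nonZeroDivisors A)
    (hF : Function.Bijective (_root_.frobenius (ModP A p) p)) :
    Nonempty (A ≃+* WittVector p (ModP A p)) :=
  ⟨(RingEquiv.ofBijective (fontaineTheta A p)
      ⟨fontaineTheta_injective hp hF.1, surjective_fontaineTheta hF.2⟩).symm.trans
    (ringEquivOfRingEquiv (RingEquiv.ofBijective (Perfection.coeff (ModP A p) p 0)
      ⟨Perfection.coeff_zero_injective hF.1, Perfection.coeff_surjective hF.2 0⟩))⟩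

end WittVector


/-- Let `R` be a perfect commutative ring of characteristic `p`.
The ring `W(R)` of `p`-typical Witt vectors is `p`-adically complete and separated,
`p` is a nonzerodivisor in `W(R)`, and `W(R)/pW(R) ≅ R`; moreover any `p`-adically
complete and separated commutative ring `A` in which `p` is a nonzerodivisor and
with `A/pA ≅ R` is isomorphic to `W(R)`. -/
theorem wittVector_isAdicComplete_nonZeroDivisor_quotient_and_unique
    (p : ℕ) [Fact p.Prime]
    (R : Type*) [CommRing R] [CharP R p] [PerfectRing R p] :
    IsAdicComplete (Ideal.span {(p : WittVector p R)}) (WittVector p R) ∧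
    (p : WittVector p R) ∈ nonZeroDivisors (WittVector p R) ∧
    Nonempty ((WittVector p R ⧸ Ideal.span {(p : WittVector p R)}) ≃+* R) ∧
    (∀ (A : Type*) [CommRing A],
      IsAdicComplete (Ideal.span {(p : A)}) A →
      (p : A) ∈ nonZeroDivisors A →
      Nonempty ((A ⧸ Ideal.span {(p : A)}) ≃+* R) →
      Nonempty (A ≃+* WittVector p R)) := by
  refine ⟨inferInstance, ?_, ⟨WittVector.quotientPEquiv⟩, ?_⟩
  · rw [mem_nonZeroDivisors_iff_right]
    exact WittVector.eq_zero_of_p_mul_eq_zero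
  · rintro A _ _ hp ⟨e⟩
    have : Fact ¬IsUnit (p : A) := ⟨fun hu ↦ by
      have := CharP.nontrivial_of_char_ne_one (R := R) (Fact.out : p.Prime).ne_one
      have := e.toEquiv.nontrivial
      exact Ideal.Quotient.nontrivial_iff.mp this (Ideal.span_singleton_eq_top.mpr hu)⟩
    let e' : ModP A p ≃+* R := e
    have hF : Function.Bijective (frobenius (ModP A p) p) := by
      have h : ⇑(frobenius (ModP A p) p) = e'.symm ∘ frobenius R p ∘ e' := by
        ext x
        simp [frobenius_def]
      rw [h]
      exact e'.symm.bijective.comp ((PerfectRing.bijective_frobenius (R := R)).comp e'.bijective)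
    obtain ⟨f⟩ := WittVector.nonempty_ringEquiv_of_bijective_frobenius hp hF
    exact ⟨f.trans (WittVector.ringEquivOfRingEquiv e')⟩
end

section
/- Let R be a perfect commutative ring of characteristic p and S a commutative ring that is p-adically complete and separated. Then every ring homomorphism f : R → S/pS lifts uniquely to W(R): there is a unique ring homomorphism g : W(R) → S such that the composite W(R) → S → S/pS equals f composed with the zeroth-Witt-component ring homomorphism W(R) → R (which induces the isomorphism W(R)/pW(R) ≅ R). -/
namespace WittVector

open Ideal Quotient

theorem isNilpotent_natCast_quotient_span_pow {S : Type*} [CommRing S] (p n : ℕ) :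
    IsNilpotent ((p : ℕ) : S ⧸ span {(p : S)} ^ n) := by
  refine ⟨n, ?_⟩
  rw [← map_natCast (Ideal.Quotient.mk (span {(p : S)} ^ n)), ← map_pow,
    Ideal.Quotient.eq_zero_iff_mem]
  exact Ideal.pow_mem_pow (mem_span_singleton_self _) _

variable {p : ℕ} [Fact p.Prime] {S : Type*} [CommRing S]

theorem ghostComponentModPPow_teichmuller_mk (n : ℕ) (s : S) :
    ghostComponentModPPow n (teichmuller p (Ideal.Quotient.mk (span {(p : S)}) s)) =
      Ideal.Quotient.mk (span {(p : S)} ^ (n + 1)) (s ^ p ^ n) := by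
  simpa using ghostComponentModPPow_map_mk n (teichmuller p s)

variable {R : Type*} [CommRing R] [CharP R p] [PerfectRing R p]

/-- The lift of `f : R →+* S ⧸ (p)` to a ring homomorphism `W(R) →+* S ⧸ (p) ^ (n + 1)`. -/
noncomputable def liftModPPow (f : R →+* S ⧸ span {(p : S)}) (n : ℕ) :
    WittVector p R →+* S ⧸ span {(p : S)} ^ (n + 1) :=
  (ghostComponentModPPow n).comp ((WittVector.map f).comp
    (WittVector.map ((_root_.frobeniusEquiv R p).symm ^ n : R →+* R)))

theorem liftModPPow_teichmuller (f : R →+* S ⧸ span {(p : S)}) (n : ℕ) {x y : R} {s : S}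
    (hy : y ^ p ^ n = x) (hs : Ideal.Quotient.mk (span {(p : S)}) s = f y) :
    liftModPPow f n (teichmuller p x) = Ideal.Quotient.mk _ (s ^ p ^ n) := by
  have hroot : ((_root_.frobeniusEquiv R p).symm ^ n : R →+* R) x = y := by
    subst hy
    clear hs
    induction n with
    | zero => simp
    | succ n ih =>
      rw [pow_succ (n := n), RingHom.mul_def, RingHom.comp_apply, pow_succ p, pow_mul]
      simp [frobeniusEquiv_symm_pow, ih]
  rw [liftModPPow, RingHom.comp_apply, RingHom.comp_apply, map_teichmuller, hroot,
    map_teichmuller, ← hs, ghostComponentModPPow_teichmuller_mk]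

theorem factorPowSucc_comp_liftModPPow (f : R →+* S ⧸ span {(p : S)}) (n : ℕ) :
    (factorPowSucc _ _).comp (liftModPPow f (n + 1)) = liftModPPow f n := by
  refine eq_of_apply_teichmuller_eq _ _ (isNilpotent_natCast_quotient_span_pow _ _) fun x ↦ ?_
  obtain ⟨y, rfl⟩ := (bijective_iterateFrobenius R p (n := n + 1)).surjective x
  obtain ⟨s, hs⟩ := Ideal.Quotient.mk_surjective (f y)
  rw [RingHom.comp_apply,
    liftModPPow_teichmuller f (n + 1) (y := y) (iterateFrobenius_def ..).symm hs,
    liftModPPow_teichmuller f n (y := y ^ p) (s := s ^ p) _ (by simp [hs])]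
  · simp [pow_succ', pow_mul]
  · rw [iterateFrobenius_def, pow_succ', pow_mul]

theorem mk_pow_comp_eq_of_mk_comp_eq {g h : WittVector p R →+* S}
    (hgh : (Ideal.Quotient.mk (span {(p : S)})).comp g =
      (Ideal.Quotient.mk (span {(p : S)})).comp h) (n : ℕ) :
    (Ideal.Quotient.mk (span {(p : S)} ^ n)).comp g =
      (Ideal.Quotient.mk (span {(p : S)} ^ n)).comp h := by
  refine eq_of_apply_teichmuller_eq _ _ (isNilpotent_natCast_quotient_span_pow _ _) fun x ↦ ?_
  obtain ⟨y, rfl⟩ := (bijective_iterateFrobenius R p (n := n)).surjective x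
  have hy : (p : S) ∣ g (teichmuller p y) - h (teichmuller p y) := by
    rw [← mem_span_singleton, ← Ideal.Quotient.eq]
    exact RingHom.congr_fun hgh _
  rw [iterateFrobenius_def, map_pow, RingHom.comp_apply, RingHom.comp_apply, map_pow g, map_pow h,
    Ideal.Quotient.eq, span_singleton_pow, mem_span_singleton]
  exact (pow_dvd_pow _ n.le_succ).trans (dvd_sub_pow_of_dvd_sub hy n)

theorem ringHom_eq_of_mk_comp_eq [IsHausdorff (span {(p : S)}) S] {g h : WittVector p R →+* S}
    (hgh : (Ideal.Quotient.mk (span {(p : S)})).comp g =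
      (Ideal.Quotient.mk (span {(p : S)})).comp h) : g = h := by
  ext x
  rw [IsHausdorff.eq_iff_smodEq (I := span {(p : S)})]
  intro n
  rw [smul_eq_mul, mul_top]
  exact RingHom.congr_fun (mk_pow_comp_eq_of_mk_comp_eq hgh n) x

/-- The lift of `f : R →+* S ⧸ (p)` to a ring homomorphism `W(R) →+* S`, for `R` perfect of
characteristic `p` and `S` a `p`-adically complete ring. -/
noncomputable def liftOfIsAdicComplete [IsAdicComplete (span {(p : S)}) S]
    (f : R →+* S ⧸ span {(p : S)}) : WittVector p R →+* S :=
  IsAdicComplete.StrictMono.liftRingHom (span {(p : S)}) Order.succ_strictMono (liftModPPow f)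
    (factorPowSucc_comp_liftModPPow f _)

theorem mk_liftOfIsAdicComplete [IsAdicComplete (span {(p : S)}) S]
    (f : R →+* S ⧸ span {(p : S)}) (x : WittVector p R) :
    Ideal.Quotient.mk (span {(p : S)}) (liftOfIsAdicComplete f x) = f (x.coeff 0) := by
  have h : Ideal.Quotient.mk (span {(p : S)} ^ (0 + 1)) (liftOfIsAdicComplete f x) =
      liftModPPow f 0 x :=
    IsAdicComplete.StrictMono.mk_liftRingHom (span {(p : S)}) Order.succ_strictMono
      (liftModPPow f) (factorPowSucc_comp_liftModPPow f _) x
  have h1 : span {(p : S)} ^ (0 + 1) = span {(p : S)} := by simp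
  apply_fun quotEquivOfEq h1 at h
  rw [quotEquivOfEq_mk] at h
  rw [h]
  simp [liftModPPow, ghostComponent_apply, RingHom.one_def]

end WittVector

/-- Let `R` be a perfect commutative ring of characteristic `p` and
`S` a commutative ring which is `p`-adically complete and separated.  Then every ring
homomorphism `f : R → S/pS` lifts uniquely to `W(R)`: there is a unique ring
homomorphism `g : W(R) → S` with `(S → S/pS) ∘ g = f ∘ π`, where
`π : W(R) → R` is the zeroth-Witt-component ring homomorphism `x ↦ x.coeff 0`
(which induces `W(R)/pW(R) ≅ R`). -/
theorem wittVector_lift_ringHom_unique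
    (p : ℕ) [Fact p.Prime]
    (R : Type*) [CommRing R] [CharP R p] [PerfectRing R p]
    (S : Type*) [CommRing S] (hS : IsAdicComplete (Ideal.span {(p : S)}) S)
    (π : WittVector p R →+* R) (hπ : ∀ x : WittVector p R, π x = x.coeff 0)
    (f : R →+* S ⧸ Ideal.span {(p : S)}) :
    ∃! g : WittVector p R →+* S,
      (Ideal.Quotient.mk (Ideal.span {(p : S)})).comp g = f.comp π := by
  have hmk (x : WittVector p R) := WittVector.mk_liftOfIsAdicComplete f x
  refine ⟨WittVector.liftOfIsAdicComplete f, RingHom.ext fun x ↦ ?_, fun g hg ↦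
    WittVector.ringHom_eq_of_mk_comp_eq (hg.trans (RingHom.ext fun x ↦ ?_))⟩ <;>
  simp [hπ, hmk]
end

section
/- Let p be a prime, R a commutative ring with no p-torsion, and I ⊆ R an ideal such that R/I has no p-torsion and such that f^p ∈ pR for every f ∈ I. Then for every f ∈ I and every integer n ≥ 1, the power p^{v_p(n!)} divides f^n in R, where v_p(n!) denotes the p-adic valuation of n!; in particular, if R is a ℤ_{(p)}-algebra, then for each such f and n there is a unique element g ∈ R with n!·g = f^n. -/
/-- If the `p`-th power of every element of an ideal `I` lies in `p I`, then `p ^ v_p(n!)` divides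
`f ^ n` for every `f ∈ I`. -/
theorem pow_padicValNat_factorial_dvd_pow {R : Type*} [CommRing R] (p : ℕ) [Fact p.Prime]
    {I : Ideal R} (hI : ∀ f ∈ I, ∃ g ∈ I, f ^ p = p * g) {f : R} (hf : f ∈ I) (n : ℕ) :
    (p : R) ^ padicValNat p n.factorial ∣ f ^ n := by
  have hp : p.Prime := Fact.out
  induction n using Nat.strong_induction_on generalizing f with
  | _ n ih =>
    rcases Nat.eq_zero_or_pos n with rfl | hn
    · simp
    obtain ⟨g, hg, hfg⟩ := hI f hf
    have hpow : f ^ n = (p : R) ^ (n / p) * g ^ (n / p) * f ^ (n % p) := by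
      rw [← mul_pow, ← hfg, ← pow_mul, ← pow_add, Nat.div_add_mod]
    rw [hpow, ← padicValNat_mul_div_factorial, padicValNat_factorial_mul, add_comm, pow_add]
    exact Dvd.dvd.mul_right (mul_dvd_mul_left _ (ih _ (Nat.div_lt_self hn hp.one_lt) hg)) _


/-- Let `p` be a prime, `R` a commutative ring with no `p`-torsion,
and `I ⊆ R` an ideal such that `R/I` has no `p`-torsion and `f^p ∈ pR` for every
`f ∈ I`.  Then for every `f ∈ I` and every `n ≥ 1` the power `p^{v_p(n!)}` divides
`f^n` in `R`; in particular if `R` is a `ℤ_{(p)}`-algebra (equivalently, every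
natural number coprime to `p` is invertible in `R`), then for each such `f` and `n`
there is a unique `g ∈ R` with `n! · g = f^n`. -/
theorem pow_padicValNat_factorial_dvd_pow_of_pow_mem_span
    (p : ℕ) [Fact p.Prime] (R : Type*) [CommRing R]
    (hR : ∀ x : R, (p : R) * x = 0 → x = 0)
    (I : Ideal R)
    (hRI : ∀ x : R ⧸ I, (p : R ⧸ I) * x = 0 → x = 0)
    (hIp : ∀ f ∈ I, f ^ p ∈ Ideal.span {(p : R)}) :
    (∀ f ∈ I, ∀ n : ℕ, 1 ≤ n →
      (p : R) ^ (padicValNat p (Nat.factorial n)) ∣ f ^ n) ∧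
    ((∀ m : ℕ, ¬ p ∣ m → IsUnit (m : R)) → ∀ f ∈ I, ∀ n : ℕ, 1 ≤ n →
      ∃! g : R, (Nat.factorial n : R) * g = f ^ n) := by
  have hp : p.Prime := Fact.out
  have hreg : IsLeftRegular (p : R) := fun x y hxy =>
    sub_eq_zero.mp (hR _ (by rw [mul_sub]; exact sub_eq_zero.mpr hxy))
  have hdvd : ∀ f ∈ I, ∀ n : ℕ, (p : R) ^ padicValNat p n.factorial ∣ f ^ n := by
    refine fun f hf n => pow_padicValNat_factorial_dvd_pow p (fun f hf => ?_) hf n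
    obtain ⟨g, hg⟩ := Ideal.mem_span_singleton.mp (hIp f hf)
    refine ⟨g, Ideal.Quotient.eq_zero_iff_mem.mp (hRI _ ?_), hg⟩
    have hmem : (p : R) * g ∈ I := hg ▸ I.pow_mem_of_mem hf p hp.pos
    simpa using Ideal.Quotient.eq_zero_iff_mem.mpr hmem
  refine ⟨fun f hf n _ => hdvd f hf n, fun hu f hf n _ => ?_⟩
  obtain ⟨m, hm, hnm⟩ : ∃ m : ℕ, ¬ p ∣ m ∧ n.factorial = p ^ padicValNat p n.factorial * m := by
    obtain ⟨m, hm⟩ := pow_padicValNat_dvd (p := p) (n := n.factorial)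
    refine ⟨m, fun ⟨k, hk⟩ => ?_, hm⟩
    refine pow_succ_padicValNat_not_dvd (p := p) n.factorial_ne_zero ⟨k, ?_⟩
    rw [pow_succ, mul_assoc, ← hk, ← hm]
  have hfact : (n.factorial : R) = (p : R) ^ padicValNat p n.factorial * m := by
    exact_mod_cast congrArg (Nat.cast : ℕ → R) hnm
  have hinj : IsLeftRegular (n.factorial : R) :=
    hfact ▸ (hreg.pow _).mul (hu m hm).isRegular.left
  obtain ⟨g, hg⟩ : (n.factorial : R) ∣ f ^ n := by
    rw [hfact, (hu m hm).mul_right_dvd]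
    exact hdvd f hf n
  exact ⟨g, hg.symm, fun y hy => hinj (hy.trans hg)⟩
end

section
/- Let p be a prime, n ≥ 1, and φ : A_• → B_• a morphism of chain complexes of ℤ/p^nℤ-modules all of whose terms are flat ℤ/p^nℤ-modules. If the degreewise reduction modulo p, A_• ⊗_{ℤ/p^nℤ} ℤ/pℤ → B_• ⊗_{ℤ/p^nℤ} ℤ/pℤ, is a quasi-isomorphism, then φ itself is a quasi-isomorphism. (Since the terms are flat, the degreewise tensor product computes the derived tensor product, so this says: if φ ⊗^L ℤ/pℤ is a quasi-isomorphism then so is φ.) -/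
open CategoryTheory

/-- An element of `ℤ/p^nℤ` killed by `p^k` with `k < n` is divisible by `p`. -/
lemma ZMod.exists_eq_mul_of_pow_mul_eq_zero {p n k : ℕ} (hp : p ≠ 0) (hk : k < n)
    (a : ZMod (p ^ n)) (ha : (p : ZMod (p ^ n)) ^ k * a = 0) : ∃ c, a = p * c := by
  have : NeZero (p ^ n) := ⟨pow_ne_zero n hp⟩
  have hdvd : p ^ n ∣ p ^ k * a.val := by
    rw [← ZMod.natCast_eq_zero_iff]
    simpa using ha
  have hp_dvd : p ∣ a.val := by
    refine Nat.dvd_of_mul_dvd_mul_left (pow_pos (Nat.pos_of_ne_zero hp) k) ?_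
    rw [← pow_succ]
    exact (pow_dvd_pow p hk).trans hdvd
  obtain ⟨c, hc⟩ := hp_dvd
  refine ⟨c, ?_⟩
  rw [← ZMod.natCast_zmod_val a, hc]
  push_cast
  rfl

/-- An element of a flat `ℤ/p^nℤ`-module killed by `p^k` with `k < n` is divisible by `p`. -/
lemma Module.Flat.exists_eq_smul_of_pow_smul_eq_zero {p n k : ℕ} (hp : p ≠ 0) (hk : k < n)
    {M : Type*} [AddCommGroup M] [Module (ZMod (p ^ n)) M] [Module.Flat (ZMod (p ^ n)) M]
    (x : M) (hx : p ^ k • x = 0) : ∃ c : M, x = p • c := by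
  have hrel : ∑ _i : Unit, ((p : ZMod (p ^ n)) ^ k) • x = 0 := by
    rw [← Nat.cast_smul_eq_nsmul (ZMod (p ^ n))] at hx
    simpa using hx
  obtain ⟨l, a, y, hxy, ha⟩ := Module.Flat.isTrivialRelation_of_sum_smul_eq_zero
    (f := fun _ : Unit ↦ (p : ZMod (p ^ n)) ^ k) (x := fun _ ↦ x) hrel
  choose c hc using fun j ↦ ZMod.exists_eq_mul_of_pow_mul_eq_zero hp hk (a () j)
    (by simpa using ha j)
  refine ⟨∑ j, c j • y j, ?_⟩
  rw [show x = _ from hxy (), ← Nat.cast_smul_eq_nsmul (ZMod (p ^ n)), Finset.smul_sum]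
  exact Finset.sum_congr rfl fun j _ ↦ by rw [hc j, mul_smul]

namespace HomologicalComplex

variable {R : Type*} [Ring R] {ι : Type*} {c : ComplexShape ι}

lemma moduleCat_d_apply_d_apply (K : HomologicalComplex (ModuleCat R) c) (i j k : ι)
    (x : K.X i) : K.d j k (K.d i j x) = 0 := by
  simp [← ConcreteCategory.comp_apply]

lemma moduleCat_f_apply_d_apply {K L : HomologicalComplex (ModuleCat R) c} (φ : K ⟶ L)
    (i j : ι) (x : K.X i) : φ.f j (K.d i j x) = L.d i j (φ.f i x) := by
  simp only [← ConcreteCategory.comp_apply, φ.comm]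

lemma moduleCat_exists_iCycles_eq (K : HomologicalComplex (ModuleCat R) c) {j k : ι}
    (hk : c.next j = k) (x : K.X j) (hx : K.d j k x = 0) :
    ∃ z : K.cycles j, K.iCycles j z = x := by
  have h := ShortComplex.exact_of_f_is_kernel
    (ShortComplex.mk (K.iCycles j) (K.d j k) (K.iCycles_d j k)) (K.cyclesIsKernel j k hk)
  exact (ShortComplex.moduleCat_exact_iff _).1 h x hx

lemma moduleCat_homologyπ_eq_zero_iff (K : HomologicalComplex (ModuleCat R) c) {i j : ι}
    (hi : c.prev j = i) (z : K.cycles j) :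
    K.homologyπ j z = 0 ↔ ∃ y : K.X i, K.d i j y = K.iCycles j z := by
  have hinj := (ModuleCat.mono_iff_injective (K.iCycles j)).1 inferInstance
  have h := ShortComplex.exact_of_g_is_cokernel
    (ShortComplex.mk (K.toCycles i j) (K.homologyπ j) (K.toCycles_comp_homologyπ i j))
    (K.homologyIsCokernel i j hi)
  constructor
  · intro hz
    obtain ⟨y, hy⟩ := (ShortComplex.moduleCat_exact_iff _).1 h z hz
    refine ⟨y, ?_⟩
    rw [← K.toCycles_i i j, ConcreteCategory.comp_apply]
    exact congrArg _ hy
  · rintro ⟨y, hy⟩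
    rw [← K.toCycles_i i j, ConcreteCategory.comp_apply] at hy
    rw [← hinj hy, ← ConcreteCategory.comp_apply, K.toCycles_comp_homologyπ]
    rfl

/-- Elementwise criterion for a morphism of complexes of modules to be a quasi-isomorphism
in a given degree. -/
lemma moduleCat_quasiIsoAt {K L : HomologicalComplex (ModuleCat R) c} (φ : K ⟶ L)
    {i j k : ι} (hi : c.prev j = i) (hk : c.next j = k)
    (hsurj : ∀ x : L.X j, L.d j k x = 0 →
      ∃ a : K.X j, K.d j k a = 0 ∧ ∃ y : L.X i, φ.f j a - x = L.d i j y)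
    (hinj : ∀ a : K.X j, K.d j k a = 0 → (∃ y : L.X i, φ.f j a = L.d i j y) →
      ∃ z : K.X i, a = K.d i j z) :
    QuasiIsoAt φ j := by
  have hπK := (ModuleCat.epi_iff_surjective (K.homologyπ j)).1 inferInstance
  have hπL := (ModuleCat.epi_iff_surjective (L.homologyπ j)).1 inferInstance
  have hnat (z : K.cycles j) :
      homologyMap φ j (K.homologyπ j z) = L.homologyπ j (cyclesMap φ j z) := by
    simp only [← ConcreteCategory.comp_apply, homologyπ_naturality]
  have hi_nat (z : K.cycles j) :
      L.iCycles j (cyclesMap φ j z) = φ.f j (K.iCycles j z) := by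
    simp only [← ConcreteCategory.comp_apply, cyclesMap_i]
  have hdi (M : HomologicalComplex (ModuleCat R) c) (z : M.cycles j) :
      M.d j k (M.iCycles j z) = 0 := by
    rw [← ConcreteCategory.comp_apply, iCycles_d]
    rfl
  rw [quasiIsoAt_iff_isIso_homologyMap, ConcreteCategory.isIso_iff_bijective]
  constructor
  · rw [injective_iff_map_eq_zero]
    intro x hx
    obtain ⟨z, rfl⟩ := hπK x
    rw [hnat, moduleCat_homologyπ_eq_zero_iff L hi] at hx
    obtain ⟨y, hy⟩ := hx
    obtain ⟨w, hw⟩ := hinj (K.iCycles j z) (hdi K z) ⟨y, by rw [hy, hi_nat]⟩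
    exact (moduleCat_homologyπ_eq_zero_iff K hi z).2 ⟨w, hw.symm⟩
  · intro x
    obtain ⟨z, rfl⟩ := hπL x
    obtain ⟨a, ha, y, hy⟩ := hsurj (L.iCycles j z) (hdi L z)
    obtain ⟨w, rfl⟩ := moduleCat_exists_iCycles_eq K hk a ha
    refine ⟨K.homologyπ j w, ?_⟩
    rw [hnat, ← sub_eq_zero, ← map_sub, moduleCat_homologyπ_eq_zero_iff L hi]
    exact ⟨y, by rw [map_sub, hi_nat, hy]⟩

end HomologicalComplex

open HomologicalComplex


/-- **dévissage.** Let `p` be a prime, `n ≥ 1`, and `φ : A_• → B_•` a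
morphism of chain complexes of `ℤ/p^nℤ`-modules with flat terms.  If the degreewise
reduction modulo `p` (i.e. the induced morphism of quotient complexes
`A_•/pA_• → B_•/pB_•`, which by flatness computes `φ ⊗^L ℤ/pℤ`) is a
quasi-isomorphism, then `φ` is a quasi-isomorphism.  The quasi-isomorphism
hypothesis on the reduction is spelled out elementwise: the induced maps on the
homology of the mod-`p` complexes are surjective and injective in every degree. -/
theorem quasiIso_of_quasiIso_mod_p
    (p : ℕ) [Fact p.Prime] (n : ℕ) (hn : 1 ≤ n)
    (A B : ChainComplex (ModuleCat (ZMod (p ^ n))) ℤ)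
    (hA : ∀ i : ℤ, Module.Flat (ZMod (p ^ n)) (A.X i))
    (hB : ∀ i : ℤ, Module.Flat (ZMod (p ^ n)) (B.X i))
    (φ : A ⟶ B)
    -- surjectivity of `H_i(A/pA) → H_i(B/pB)` for all `i` :
    (hsurj : ∀ i : ℤ, ∀ x : B.X i, (∃ c, B.d i (i - 1) x = p • c) →
      ∃ a : A.X i, (∃ c, A.d i (i - 1) a = p • c) ∧
        ∃ (y : B.X (i + 1)) (u : B.X i), φ.f i a - x = B.d (i + 1) i y + p • u)
    -- injectivity of `H_i(A/pA) → H_i(B/pB)` for all `i` :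
    (hinj : ∀ i : ℤ, ∀ a : A.X i, (∃ c, A.d i (i - 1) a = p • c) →
      (∃ (y : B.X (i + 1)) (u : B.X i), φ.f i a = B.d (i + 1) i y + p • u) →
      ∃ (z : A.X (i + 1)) (w : A.X i), a = A.d (i + 1) i z + p • w) :
    QuasiIso φ := by
  have hp : p ≠ 0 := (Fact.out : p.Prime).ne_zero
  -- Acyclicity modulo `p` of the mapping cone of `φ`.
  have cone_mod (k : ℤ) (a : A.X k) (b : B.X (k + 1)) (ha : ∃ c, A.d k (k - 1) a = p • c)
      (hab : ∃ c, φ.f k a - B.d (k + 1) k b = p • c) :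
      ∃ (z : A.X (k + 1)) (y : B.X (k + 1 + 1)) (u : A.X k) (v : B.X (k + 1)),
        a = A.d (k + 1) k z + p • u ∧
          b = φ.f (k + 1) z + B.d (k + 1 + 1) (k + 1) y + p • v := by
    obtain ⟨c, hc⟩ := hab
    obtain ⟨z, w, rfl⟩ := hinj k a ha ⟨b, c, by rw [← hc]; abel⟩
    have hz : ∃ e, B.d (k + 1) (k + 1 - 1) (b - φ.f (k + 1) z) = p • e := by
      rw [show k + 1 - 1 = k by ring]
      refine ⟨φ.f k w - c, ?_⟩
      rw [smul_sub, ← hc, map_sub, map_add, map_nsmul, moduleCat_f_apply_d_apply]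
      abel
    obtain ⟨a', ha', y, v, hy⟩ := hsurj (k + 1) _ hz
    rw [show k + 1 - 1 = k by ring] at ha'
    obtain ⟨e, he⟩ := ha'
    refine ⟨z + a', -y, w - e, -v, ?_, ?_⟩
    · rw [map_add, he, smul_sub]
      abel
    · rw [map_add, map_neg, smul_neg]
      have hb : b = φ.f (k + 1) z + φ.f (k + 1) a' -
          (φ.f (k + 1) a' - (b - φ.f (k + 1) z)) := by abel
      rw [hb, hy]
      abel
  -- Lifting along the powers of `p`.
  have cone_pow (k : ℤ) (a : A.X k) (b : B.X (k + 1)) (ha : A.d k (k - 1) a = 0)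
      (hab : φ.f k a = B.d (k + 1) k b) (m : ℕ) (hm : m ≤ n) :
      ∃ (z : A.X (k + 1)) (y : B.X (k + 1 + 1)) (u : A.X k) (v : B.X (k + 1)),
        a = A.d (k + 1) k z + p ^ m • u ∧
          b = φ.f (k + 1) z + B.d (k + 1 + 1) (k + 1) y + p ^ m • v := by
    induction m with
    | zero => exact ⟨0, 0, a, b, by simp, by simp⟩
    | succ m ih =>
      obtain ⟨z, y, u, v, hu, hv⟩ := ih (by lia)
      have hdu : p ^ m • A.d k (k - 1) u = 0 := by
        rw [hu, map_add, map_nsmul, moduleCat_d_apply_d_apply, zero_add] at ha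
        exact ha
      have huv : p ^ m • (φ.f k u - B.d (k + 1) k v) = 0 := by
        rw [hu, hv] at hab
        simp only [map_add, map_nsmul, moduleCat_d_apply_d_apply, moduleCat_f_apply_d_apply,
          add_zero, add_right_inj] at hab
        rw [smul_sub, hab, sub_self]
      obtain ⟨z', y', u', v', rfl, rfl⟩ := cone_mod k u v
        (have := hA (k - 1); Module.Flat.exists_eq_smul_of_pow_smul_eq_zero hp hm _ hdu)
        (have := hB k; Module.Flat.exists_eq_smul_of_pow_smul_eq_zero hp hm _ huv)
      refine ⟨z + p ^ m • z', y + p ^ m • y', u', v', ?_, ?_⟩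
      · rw [hu, map_add, map_nsmul, pow_succ, mul_smul, smul_add]
        abel
      · rw [hv]
        simp only [map_add, map_nsmul, pow_succ, mul_smul, smul_add]
        abel
  have cone (k : ℤ) (a : A.X k) (b : B.X (k + 1)) (ha : A.d k (k - 1) a = 0)
      (hab : φ.f k a = B.d (k + 1) k b) :
      ∃ (z : A.X (k + 1)) (y : B.X (k + 1 + 1)), a = A.d (k + 1) k z ∧
        b = φ.f (k + 1) z + B.d (k + 1 + 1) (k + 1) y := by
    obtain ⟨z, y, u, v, hu, hv⟩ := cone_pow k a b ha hab n le_rfl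
    have hzero (M : ModuleCat (ZMod (p ^ n))) (x : M) : p ^ n • x = 0 := by
      rw [← Nat.cast_smul_eq_nsmul (ZMod (p ^ n)), ZMod.natCast_self, zero_smul]
    rw [hzero, add_zero] at hu hv
    exact ⟨z, y, hu, hv⟩
  refine ⟨fun j ↦ ?_⟩
  obtain ⟨k, rfl⟩ : ∃ k, j = k + 1 := ⟨j - 1, by ring⟩
  refine moduleCat_quasiIsoAt φ (i := k + 1 + 1) (k := k) (by simp) (by simp) ?_ ?_
  · intro x hx
    obtain ⟨z, y, hz, hy⟩ := cone k 0 x (map_zero _) (by rw [hx, map_zero])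
    exact ⟨z, hz.symm, -y, by rw [hy, map_neg]; abel⟩
  · rintro a ha ⟨b, hb⟩
    obtain ⟨z, -, hz, -⟩ := cone (k + 1) a b
      (by rw [show k + 1 - 1 = k by ring]; exact ha) hb
    exact ⟨z, hz⟩
end

section
/- Let p be a prime and A → B a ring homomorphism of perfect commutative 𝔽_p-algebras (commutative rings of characteristic p whose Frobenius endomorphism x ↦ x^p is bijective). Then Ω¹_{B/A} = 0 and the first André–Quillen homology H₁(L_{B/A}) vanishes (indeed the whole cotangent complex L_{B/A} is acyclic). -/
namespace PerfectRing

variable (p : ℕ) [Fact p.Prime] {A B C : Type*} [CommRing A] [CommRing B] [CommRing C]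
  [Algebra A B] [Algebra A C]

/-- An algebra homomorphism out of a perfect ring is determined by its reduction modulo a
square-zero ideal. -/
theorem quotient_mkₐ_comp_injective [CharP B p] [PerfectRing B p] [CharP C p]
    (I : Ideal C) (hI : I ^ 2 = ⊥) :
    Function.Injective ((Ideal.Quotient.mkₐ A I).comp : (B →ₐ[A] C) → B →ₐ[A] C ⧸ I) := by
  intro f g h
  ext b
  obtain ⟨c, rfl⟩ := (frobeniusEquiv B p).surjective b
  have hc : f c - g c ∈ I := Ideal.Quotient.eq.mp (DFunLike.congr_fun h c)
  have hp : (f c - g c) ^ p = 0 := by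
    rw [← Ideal.mem_bot, ← hI]
    exact Ideal.pow_le_pow_right (Fact.out : p.Prime).two_le (Ideal.pow_mem_pow hc p)
  rw [sub_pow_char, sub_eq_zero] at hp
  simpa [frobeniusEquiv_apply, frobenius_def] using hp

/-- Algebra homomorphisms between perfect rings lift along square-zero thickenings. -/
theorem quotient_mkₐ_comp_surjective [CharP A p] [PerfectRing A p] [CharP B p] [PerfectRing B p]
    [CharP C p] (I : Ideal C) (hI : I ^ 2 = ⊥) :
    Function.Surjective ((Ideal.Quotient.mkₐ A I).comp : (B →ₐ[A] C) → B →ₐ[A] C ⧸ I) := by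
  intro f
  have hker : ∀ x ∈ I, frobenius C p x = 0 := fun x hx ↦ by
    rw [frobenius_def, ← Ideal.mem_bot, ← hI]
    exact Ideal.pow_le_pow_right (Fact.out : p.Prime).two_le (Ideal.pow_mem_pow hx p)
  let φ : C ⧸ I →+* C := Ideal.Quotient.lift I (frobenius C p) hker
  have hφ (y : C ⧸ I) : Ideal.Quotient.mk I (φ y) = y ^ p := by
    obtain ⟨x, rfl⟩ := Ideal.Quotient.mk_surjective y
    simp [φ, frobenius_def]
  let g : B →+* C := (φ.comp (f : B →+* C ⧸ I)).comp (frobeniusEquiv B p).symm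
  have hg (b : B) : g (b ^ p) = φ (f b) := by
    have : (frobeniusEquiv B p).symm (b ^ p) = b := (frobeniusEquiv B p).symm_apply_apply b
    simp [g]
  refine ⟨{ g with commutes' := fun a ↦ ?_ }, ?_⟩
  · obtain ⟨a, rfl⟩ := (frobeniusEquiv A p).surjective a
    change g (algebraMap A B (a ^ p)) = algebraMap A C (a ^ p)
    rw [map_pow, hg, f.commutes, map_pow]
    rfl
  · ext b
    obtain ⟨b, rfl⟩ := (frobeniusEquiv B p).surjective b
    change Ideal.Quotient.mk I (g (b ^ p)) = f (b ^ p)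
    rw [hg, hφ, map_pow]

/-- A homomorphism of perfect rings of characteristic `p` is formally étale. -/
theorem formallyEtale (A B : Type*) [CommRing A] [CharP A p] [PerfectRing A p]
    [CommRing B] [CharP B p] [PerfectRing B p] [Algebra A B] :
    Algebra.FormallyEtale A B := by
  refine Algebra.FormallyEtale.iff_comp_bijective.mpr fun C _ _ I hI ↦ ?_
  cases subsingleton_or_nontrivial C
  · have : Subsingleton (C ⧸ I) := Ideal.Quotient.mk_surjective.subsingleton
    let z : B →ₐ[A] C :=
      { toFun := fun _ ↦ 0
        map_one' := Subsingleton.elim _ _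
        map_mul' := fun _ _ ↦ Subsingleton.elim _ _
        map_zero' := rfl
        map_add' := fun _ _ ↦ Subsingleton.elim _ _
        commutes' := fun _ ↦ Subsingleton.elim _ _ }
    exact ⟨fun f g _ ↦ AlgHom.ext fun b ↦ Subsingleton.elim _ _,
      fun f ↦ ⟨z, AlgHom.ext fun b ↦ Subsingleton.elim _ _⟩⟩
  · have hp : (p : C) = 0 := by
      rw [← map_natCast (algebraMap A C), CharP.cast_eq_zero, map_zero]
    have : CharP C p := (CharP.charP_iff_prime_eq_zero Fact.out).mpr hp
    exact ⟨quotient_mkₐ_comp_injective p I hI, quotient_mkₐ_comp_surjective p I hI⟩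

end PerfectRing


/-- Let `p` be a prime and `A → B` a homomorphism of perfect
commutative `𝔽_p`-algebras (commutative rings of characteristic `p` whose Frobenius
is bijective).  Then `Ω¹_{B/A} = 0` and the first André–Quillen homology
`H₁(L_{B/A})` vanishes. -/
theorem kaehler_subsingleton_and_h1Cotangent_subsingleton_of_perfectRing
    (p : ℕ) [Fact p.Prime]
    (A : Type*) [CommRing A] [CharP A p] [PerfectRing A p]
    (B : Type*) [CommRing B] [CharP B p] [PerfectRing B p]
    [Algebra A B] :
    Subsingleton (KaehlerDifferential A B) ∧
    Subsingleton (Algebra.H1Cotangent A B) := by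
  have := PerfectRing.formallyEtale p A B
  exact ⟨inferInstance, inferInstance⟩
end

section
/- Let A be a commutative ring and f : E_• → F_• a morphism of simplicial A-modules which induces a quasi-isomorphism on the associated chain complexes. Let L_• be a simplicial A-module each of whose terms L_n is a flat A-module. Then the degreewise tensor product f ⊗ id : E_• ⊗_A L_• → F_• ⊗_A L_• also induces a quasi-isomorphism on the associated chain complexes. -/
open CategoryTheory MonoidalCategory AlgebraicTopology

namespace SimplexCategory

open Simplicial

/-- The functor `⦋n⦌ ↦ ⦋n + 1⦌` which adjoins a new least element `0`. -/
def cone : SimplexCategory ⥤ SimplexCategory where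
  obj x := ⦋x.len + 1⦌
  map {x y} f := mkHom
    { toFun := Fin.cases 0 fun i ↦ (f.toOrderHom i).succ
      monotone' := by
        intro i j h
        induction i using Fin.cases with
        | zero => simp
        | succ i =>
          induction j using Fin.cases with
          | zero => simp at h
          | succ j => simpa using f.toOrderHom.monotone (by simpa using h) }
  map_id x := by
    ext i : 3
    induction i using Fin.cases <;> rfl
  map_comp f g := by
    ext i : 3
    induction i using Fin.cases <;> rfl

lemma cone_map_δ {n : ℕ} (i : Fin (n + 2)) : cone.map (δ i) = δ i.succ := by
  ext j : 3
  induction j using Fin.cases with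
  | zero => rfl
  | succ j => exact (Fin.succ_succAbove_succ i j).symm

lemma cone_map_σ {n : ℕ} (i : Fin (n + 1)) : cone.map (σ i) = σ i.succ := by
  ext j : 3
  induction j using Fin.cases with
  | zero => rfl
  | succ j => exact (Fin.succ_predAbove_succ i j).symm

/-- The inclusion of `⦋n⦌` as the base of its cone. -/
def coneBase : 𝟭 SimplexCategory ⟶ cone where
  app x := δ (n := x.len) 0

/-- The inclusion of the apex in the cone. -/
def coneApex (x : SimplexCategory) : ⦋0⦌ ⟶ cone.obj x :=
  SimplexCategory.const ⦋0⦌ (cone.obj x) (0 : Fin (x.len + 2))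

/-- The unique map from a cone to `⦋0⦌`. -/
def coneCollapse (x : SimplexCategory) : cone.obj x ⟶ ⦋0⦌ :=
  SimplexCategory.const (cone.obj x) ⦋0⦌ 0

lemma coneApex_comp_coneCollapse (x : SimplexCategory) :
    coneApex x ≫ coneCollapse x = 𝟙 _ :=
  Subsingleton.elim _ _

/-- The map `⦋n + 2⦌ ⟶ ⦋n + 1⦌` between cones sending the base vertices `0, …, i`
to the apex, and which is the degeneracy `σ i` on the other base vertices. -/
def coneContraction {n : ℕ} (i : Fin (n + 1)) : cone.obj ⦋n + 1⦌ ⟶ cone.obj ⦋n⦌ :=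
  mkHom (n := n + 2) (m := n + 1)
    { toFun := fun m ↦ if h : m.val ≤ i.val + 1 then 0 else ⟨m.val - 1, by omega⟩
      monotone' := by
        intro a b hab
        have : a.val ≤ b.val := hab
        dsimp only
        split_ifs
        · exact le_rfl
        · exact Fin.zero_le _
        · omega
        · exact Fin.mk_le_mk.2 (by omega) }

lemma coneContraction_val {n : ℕ} (i : Fin (n + 1)) (m : Fin (n + 3)) :
    Fin.val (n := n + 2) ((coneContraction i).toOrderHom m) =
      if m.val ≤ i.val + 1 then 0 else m.val - 1 := by
  change Fin.val (n := n + 2) (dite _ _ _) = _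
  split_ifs <;> rfl

lemma cone_map_δ_val {n : ℕ} (i : Fin (n + 2)) (m : Fin (n + 2)) :
    Fin.val (n := n + 3) ((cone.map (δ i)).toOrderHom m) =
      if m.val ≤ i.val then m.val else m.val + 1 := by
  rw [cone_map_δ]
  change (Fin.succAbove i.succ m).val = _
  grind [Fin.succAbove]

lemma cone_map_σ_val {n : ℕ} (i : Fin (n + 1)) (m : Fin (n + 3)) :
    Fin.val (n := n + 2) ((cone.map (σ i)).toOrderHom m) =
      if m.val ≤ i.val + 1 then m.val else m.val - 1 := by
  rw [cone_map_σ]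
  change (Fin.predAbove i.succ m).val = _
  grind [Fin.predAbove, Fin.coe_castPred]

lemma cone_δ_zero_comp_contraction (n : ℕ) :
    cone.map (δ 0) ≫ coneContraction (0 : Fin (n + 1)) = 𝟙 _ := by
  ext m : 3
  apply Fin.ext
  change Fin (n + 2) at m
  refine (coneContraction_val _ _).trans ?_
  erw [cone_map_δ_val]
  change _ = m.val
  grind

lemma cone_δ_last_comp_contraction (n : ℕ) :
    cone.map (δ (Fin.last (n + 1))) ≫ coneContraction (Fin.last n) =
      coneCollapse _ ≫ coneApex _ := by
  ext m : 3
  apply Fin.ext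
  change Fin (n + 2) at m
  refine (coneContraction_val _ _).trans ?_
  erw [cone_map_δ_val]
  change _ = 0
  grind

lemma cone_δ_comp_contraction_succ {n : ℕ} (i : Fin (n + 2)) (j : Fin (n + 1))
    (hij : i ≤ j.castSucc) :
    cone.map (δ i.castSucc) ≫ coneContraction j.succ = coneContraction j ≫ cone.map (δ i) := by
  ext m : 3
  apply Fin.ext
  change Fin (n + 3) at m
  refine (coneContraction_val _ _).trans ((cone_map_δ_val _ _).trans ?_).symm
  erw [coneContraction_val, cone_map_δ_val]
  grind

lemma cone_δ_comp_contraction_eq {n : ℕ} (j : Fin (n + 1)) :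
    cone.map (δ j.castSucc.succ) ≫ coneContraction j.succ =
      cone.map (δ j.castSucc.succ) ≫ coneContraction j.castSucc := by
  ext m : 3
  apply Fin.ext
  change Fin (n + 3) at m
  refine (coneContraction_val _ _).trans ((coneContraction_val _ _).trans ?_).symm
  erw [cone_map_δ_val]
  grind

lemma cone_δ_comp_contraction_castSucc {n : ℕ} (i : Fin (n + 2)) (j : Fin (n + 1))
    (hji : j.castSucc < i) :
    cone.map (δ i.succ) ≫ coneContraction j.castSucc = coneContraction j ≫ cone.map (δ i) := by
  ext m : 3
  apply Fin.ext
  change Fin (n + 3) at m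
  refine (coneContraction_val _ _).trans ((cone_map_δ_val _ _).trans ?_).symm
  erw [coneContraction_val, cone_map_δ_val]
  grind

lemma cone_σ_castSucc_comp_contraction {n : ℕ} (i j : Fin (n + 1)) (hij : i ≤ j) :
    cone.map (σ i.castSucc) ≫ coneContraction j = coneContraction j.succ ≫ cone.map (σ i) := by
  ext m : 3
  apply Fin.ext
  change Fin (n + 4) at m
  refine (coneContraction_val _ _).trans ((cone_map_σ_val _ _).trans ?_).symm
  erw [coneContraction_val, cone_map_σ_val]
  grind

lemma cone_σ_succ_comp_contraction {n : ℕ} (i j : Fin (n + 1)) (hji : j ≤ i) :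
    cone.map (σ i.succ) ≫ coneContraction j = coneContraction j.castSucc ≫ cone.map (σ i) := by
  ext m : 3
  apply Fin.ext
  change Fin (n + 4) at m
  refine (coneContraction_val _ _).trans ((cone_map_σ_val _ _).trans ?_).symm
  erw [coneContraction_val, cone_map_σ_val]
  grind

end SimplexCategory

namespace CategoryTheory.SimplicialObject

open Opposite SimplexCategory Simplicial

variable {C : Type*} [Category* C]

/-- The tensor product of two simplicial homotopies. -/
def Homotopy.tensor [MonoidalCategory C] {X Y X' Y' : SimplicialObject C}
    {f g : X ⟶ Y} {f' g' : X' ⟶ Y'} (H : Homotopy f g) (H' : Homotopy f' g') :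
    Homotopy (f ⊗ₘ f') (g ⊗ₘ g') where
  h i := H.h i ⊗ₘ H'.h i
  h_zero_comp_δ_zero n := by
    simp [SimplicialObject.δ, ← H.h_zero_comp_δ_zero, ← H'.h_zero_comp_δ_zero]
  h_last_comp_δ_last n := by
    simp [SimplicialObject.δ, ← H.h_last_comp_δ_last, ← H'.h_last_comp_δ_last]
  h_succ_comp_δ_castSucc_of_lt i j hij := by
    have h := H.h_succ_comp_δ_castSucc_of_lt i j hij
    have h' := H'.h_succ_comp_δ_castSucc_of_lt i j hij
    simp only [SimplicialObject.δ] at h h'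
    simp [SimplicialObject.δ, h, h']
  h_succ_comp_δ_castSucc_succ j := by
    have h := H.h_succ_comp_δ_castSucc_succ j
    have h' := H'.h_succ_comp_δ_castSucc_succ j
    simp only [SimplicialObject.δ] at h h'
    simp [SimplicialObject.δ, h, h']
  h_castSucc_comp_δ_succ_of_lt i j hij := by
    have h := H.h_castSucc_comp_δ_succ_of_lt i j hij
    have h' := H'.h_castSucc_comp_δ_succ_of_lt i j hij
    simp only [SimplicialObject.δ] at h h'
    simp [SimplicialObject.δ, h, h']
  h_comp_σ_castSucc_of_le i j hij := by
    have h := H.h_comp_σ_castSucc_of_le i j hij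
    have h' := H'.h_comp_σ_castSucc_of_le i j hij
    simp only [SimplicialObject.σ] at h h'
    simp [SimplicialObject.σ, h, h']
  h_comp_σ_succ_of_lt i j hij := by
    have h := H.h_comp_σ_succ_of_lt i j hij
    have h' := H'.h_comp_σ_succ_of_lt i j hij
    simp only [SimplicialObject.σ] at h h'
    simp [SimplicialObject.σ, h, h']

/-- The décalage of a simplicial object: `dec X` is `X _⦋n + 1⦌` in degree `n`, the face and
degeneracy of index zero being forgotten. -/
abbrev dec (X : SimplicialObject C) : SimplicialObject C := cone.op ⋙ X

/-- The morphism `dec X ⟶ X` given by the forgotten face maps. -/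
def decBase (X : SimplicialObject C) : dec X ⟶ X :=
  Functor.whiskerRight (NatTrans.op coneBase) X

lemma map_op_comp_map_op (X : SimplicialObject C) {x y y' z : SimplexCategory}
    {f : x ⟶ y} {g : y ⟶ z} {f' : x ⟶ y'} {g' : y' ⟶ z} (h : f ≫ g = f' ≫ g') :
    X.map g.op ≫ X.map f.op = X.map g'.op ≫ X.map f'.op := by
  rw [← X.map_comp, ← X.map_comp, ← op_comp, ← op_comp, h]

/-- The augmentation of `dec X` to the constant simplicial object `X _⦋0⦌`. -/
def decAugmentation (X : SimplicialObject C) :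
    dec X ⟶ (SimplicialObject.const C).obj (X _⦋0⦌) where
  app x := X.map (coneApex x.unop).op
  naturality x y f := by
    refine Eq.trans ?_ (Category.comp_id _).symm
    exact (X.map_comp _ _).symm

/-- The section of `decAugmentation X` given by degeneracies. -/
def decSection (X : SimplicialObject C) :
    (SimplicialObject.const C).obj (X _⦋0⦌) ⟶ dec X where
  app x := X.map (coneCollapse x.unop).op
  naturality x y f := by
    refine (Category.id_comp _).trans ?_
    exact X.map_comp (coneCollapse x.unop).op (cone.op.map f)

lemma decSection_comp_decAugmentation (X : SimplicialObject C) :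
    decSection X ≫ decAugmentation X = 𝟙 _ := by
  ext x
  refine (X.map_comp _ _).symm.trans ?_
  rw [← op_comp, coneApex_comp_coneCollapse]
  exact X.map_id _

/-- The simplicial homotopy which contracts `dec X` onto `X _⦋0⦌`. -/
def decHomotopy (X : SimplicialObject C) :
    Homotopy (decAugmentation X ≫ decSection X) (𝟙 (dec X)) where
  h i := X.map (coneContraction i).op
  h_zero_comp_δ_zero n := by
    refine (X.map_comp _ _).symm.trans ?_
    exact (congrArg (fun f ↦ X.map f.op) (cone_δ_zero_comp_contraction n)).trans (X.map_id _)
  h_last_comp_δ_last n := X.map_op_comp_map_op (cone_δ_last_comp_contraction n)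
  h_succ_comp_δ_castSucc_of_lt i j hij :=
    X.map_op_comp_map_op (cone_δ_comp_contraction_succ i j hij)
  h_succ_comp_δ_castSucc_succ j := X.map_op_comp_map_op (cone_δ_comp_contraction_eq j)
  h_castSucc_comp_δ_succ_of_lt i j hij :=
    X.map_op_comp_map_op (cone_δ_comp_contraction_castSucc i j hij)
  h_comp_σ_castSucc_of_le i j hij :=
    X.map_op_comp_map_op (cone_σ_castSucc_comp_contraction i j hij)
  h_comp_σ_succ_of_lt i j hij :=
    X.map_op_comp_map_op (cone_σ_succ_comp_contraction i j hij)

/-- The degeneracy of index zero, as a section of `decBase X` in each degree. -/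
def decBaseSection (X : SimplicialObject C) (x : SimplexCategoryᵒᵖ) :
    X.obj x ⟶ (dec X).obj x :=
  X.map (SimplexCategory.σ (n := x.unop.len) 0).op

lemma decBaseSection_comp_decBase (X : SimplicialObject C) (x : SimplexCategoryᵒᵖ) :
    decBaseSection X x ≫ (decBase X).app x = 𝟙 _ :=
  X.δ_comp_σ_self (n := x.unop.len) (i := 0)

/-- The short complex `ker ⟶ dec X ⟶ X`. -/
noncomputable abbrev decShortComplex [Abelian C] (X : SimplicialObject C) :
    ShortComplex (SimplicialObject C) :=
  ShortComplex.mk (Limits.kernel.ι (decBase X)) (decBase X) (Limits.kernel.condition _)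

/-- The short complex `ker ⟶ dec X ⟶ X` splits in each degree. -/
noncomputable def decShortComplexSplitting [Abelian C] (X : SimplicialObject C)
    (x : SimplexCategoryᵒᵖ) :
    ((decShortComplex X).map ((evaluation _ _).obj x)).Splitting := by
  have hS : (decShortComplex X).Exact := ShortComplex.exact_kernel _
  exact .ofExactOfSection _ (hS.map _) (decBaseSection X x) (decBaseSection_comp_decBase X x)
    (inferInstanceAs (Mono (((evaluation _ _).obj x).map (Limits.kernel.ι (decBase X)))))

section Tensor

variable [MonoidalCategory C]

/-- The contraction of `dec Y` onto `Y _⦋0⦌`, tensored with `X`. -/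
def tensorDecHomotopy (X Y : SimplicialObject C) :
    Homotopy (X ◁ decAugmentation Y ≫ X ◁ decSection Y) (𝟙 (X ⊗ dec Y)) := by
  have := (Homotopy.refl (𝟙 X)).tensor (decHomotopy Y)
  rwa [id_tensorHom, id_tensorHom, MonoidalCategory.whiskerLeft_comp,
    MonoidalCategory.whiskerLeft_id] at this

variable [Abelian C]

lemma quasiIso_whiskerLeft_decAugmentation (X Y : SimplicialObject C) :
    QuasiIso ((alternatingFaceMapComplex C).map (X ◁ decAugmentation Y)) := by
  let e : HomotopyEquiv ((alternatingFaceMapComplex C).obj (X ⊗ dec Y))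
      ((alternatingFaceMapComplex C).obj (X ⊗ (SimplicialObject.const C).obj (Y _⦋0⦌))) :=
    { hom := (alternatingFaceMapComplex C).map (X ◁ decAugmentation Y)
      inv := (alternatingFaceMapComplex C).map (X ◁ decSection Y)
      homotopyHomInvId := by
        have := (tensorDecHomotopy X Y).toChainHomotopy
        rwa [Functor.map_comp, Functor.map_id] at this
      homotopyInvHomId := .ofEq (by
        rw [← Functor.map_comp, ← MonoidalCategory.whiskerLeft_comp,
          decSection_comp_decAugmentation, MonoidalCategory.whiskerLeft_id, Functor.map_id]) }
  exact e.quasiIso_hom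

/-- Tensoring with a constant simplicial object amounts to tensoring each term. -/
def tensorConstIso (X : SimplicialObject C) (M : C) :
    X ⊗ (SimplicialObject.const C).obj M ≅
      ((SimplicialObject.whiskering C C).obj (tensorRight M)).obj X :=
  NatIso.ofComponents (fun _ ↦ Iso.refl _) (by
    intro x y f
    exact (Category.comp_id _).trans ((tensorHom_id _ _).trans (Category.id_comp _).symm))

variable [MonoidalPreadditive C]

lemma quasiIso_whiskerRight_const {X Y : SimplicialObject C} (f : X ⟶ Y) (M : C)
    [(tensorRight M).PreservesHomology]
    (hf : QuasiIso ((alternatingFaceMapComplex C).map f)) :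
    QuasiIso ((alternatingFaceMapComplex C).map (f ▷ (SimplicialObject.const C).obj M)) := by
  have h : QuasiIso
      ((alternatingFaceMapComplex C ⋙ (tensorRight M).mapHomologicalComplex _).map f) :=
    inferInstanceAs (QuasiIso (((tensorRight M).mapHomologicalComplex _).map _))
  rw [map_alternatingFaceMapComplex] at h
  let e : Arrow.mk (f ▷ (SimplicialObject.const C).obj M) ≅
      Arrow.mk (((SimplicialObject.whiskering C C).obj (tensorRight M)).map f) :=
    Arrow.isoMk (tensorConstIso X M) (tensorConstIso Y M) (by
      ext x
      exact (Category.id_comp _).trans (Category.comp_id _).symm)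
  exact quasiIso_of_arrow_mk_iso _ _ ((alternatingFaceMapComplex C).mapArrow.mapIso e.symm)
    (hφ := h)

instance : MonoidalPreadditive (SimplicialObject C) where
  whiskerLeft_zero := by intros; ext; simp; rfl
  zero_whiskerRight := by intros; ext; simp; rfl
  whiskerLeft_add := by intros; ext; simp; rfl
  add_whiskerRight := by intros; ext; simp; rfl

/-- The chain complexes of the tensor product of `X` with `ker ⟶ dec Y ⟶ Y`. -/
noncomputable abbrev tensorDecShortComplex (X Y : SimplicialObject C) :
    ShortComplex (ChainComplex C ℕ) :=
  ((decShortComplex Y).map (tensorLeft X)).map (alternatingFaceMapComplex C)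

lemma tensorDecShortComplex_shortExact (X Y : SimplicialObject C) :
    (tensorDecShortComplex X Y).ShortExact :=
  HomologicalComplex.shortExact_of_degreewise_shortExact _ fun n ↦
    ((decShortComplexSplitting Y (op ⦋n⦌)).map (tensorLeft (X _⦋n⦌))).shortExact

/-- The functoriality of `tensorDecShortComplex` in the first variable. -/
noncomputable def tensorDecShortComplexMap {X X' : SimplicialObject C} (f : X ⟶ X')
    (Y : SimplicialObject C) : tensorDecShortComplex X Y ⟶ tensorDecShortComplex X' Y where
  τ₁ := (alternatingFaceMapComplex C).map (f ▷ _)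
  τ₂ := (alternatingFaceMapComplex C).map (f ▷ _)
  τ₃ := (alternatingFaceMapComplex C).map (f ▷ _)
  comm₁₂ := ((alternatingFaceMapComplex C).map_comp _ _).symm.trans
    ((congrArg (alternatingFaceMapComplex C).map
      (whisker_exchange f (Limits.kernel.ι (decBase Y))).symm).trans
      ((alternatingFaceMapComplex C).map_comp _ _))
  comm₂₃ := ((alternatingFaceMapComplex C).map_comp _ _).symm.trans
    ((congrArg (alternatingFaceMapComplex C).map
      (whisker_exchange f (decBase Y)).symm).trans
      ((alternatingFaceMapComplex C).map_comp _ _))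

lemma quasiIso_whiskerRight_dec {X X' : SimplicialObject C} (f : X ⟶ X') (Y : SimplicialObject C)
    [(tensorRight (Y _⦋0⦌)).PreservesHomology]
    (hf : QuasiIso ((alternatingFaceMapComplex C).map f)) :
    QuasiIso ((alternatingFaceMapComplex C).map (f ▷ dec Y)) := by
  have := quasiIso_whiskerLeft_decAugmentation X Y
  have := quasiIso_whiskerLeft_decAugmentation X' Y
  have := quasiIso_whiskerRight_const f (Y _⦋0⦌) hf
  rw [← quasiIso_iff_comp_right _ ((alternatingFaceMapComplex C).map (X' ◁ decAugmentation Y)),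
    ← Functor.map_comp, ← whisker_exchange, Functor.map_comp]
  infer_instance

/-- Let `P` be a property of objects, stable under retracts, which implies that tensoring is exact.
If `f` induces a quasi-isomorphism on chain complexes, then so does its tensor product with any
simplicial object whose terms satisfy `P`. -/
theorem quasiIso_whiskerRight (P : ObjectProperty C) [P.IsStableUnderRetracts]
    (hP : ∀ M, P M → (tensorRight M).PreservesHomology)
    {X X' : SimplicialObject C} (f : X ⟶ X') (Y : SimplicialObject C) (hY : ∀ n, P (Y.obj n))
    (hf : QuasiIso ((alternatingFaceMapComplex C).map f)) :
    QuasiIso ((alternatingFaceMapComplex C).map (f ▷ Y)) := by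
  have hker (Y : SimplicialObject C) (hY : ∀ n, P (Y.obj n)) (n) :
      P ((decShortComplex Y).X₁.obj n) :=
    P.prop_of_retract
      { i := _, r := _, retract := (decShortComplexSplitting Y n).f_r } (hY _)
  have hdec (Y : SimplicialObject C) (hY : ∀ n, P (Y.obj n)) :
      QuasiIso (tensorDecShortComplexMap f Y).τ₂ :=
    have := hP _ (hY (op ⦋0⦌))
    quasiIso_whiskerRight_dec f Y hf
  have hepi (n : ℕ) : ∀ (Y : SimplicialObject C), (∀ n, P (Y.obj n)) →
      Epi (HomologicalComplex.homologyMap ((alternatingFaceMapComplex C).map (f ▷ Y)) n) := by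
    induction n with
    | zero =>
      intro Y hY
      have := hdec Y hY
      exact HomologicalComplex.HomologySequence.epi_homologyMap_τ₃ (tensorDecShortComplexMap f Y)
        (tensorDecShortComplex_shortExact X Y) (tensorDecShortComplex_shortExact X' Y) 0
        inferInstance (fun j hj ↦ by simp at hj) (fun j hj ↦ inferInstance)
    | succ n ih =>
      intro Y hY
      have := hdec Y hY
      refine HomologicalComplex.HomologySequence.epi_homologyMap_τ₃ (tensorDecShortComplexMap f Y)
        (tensorDecShortComplex_shortExact X Y) (tensorDecShortComplex_shortExact X' Y) (n + 1)
        inferInstance (fun j hj ↦ ?_) (fun j hj ↦ inferInstance)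
      obtain rfl : j = n := by simpa using hj
      exact ih _ (hker Y hY)
  have hmono (n : ℕ) : ∀ (Y : SimplicialObject C), (∀ n, P (Y.obj n)) →
      Mono (HomologicalComplex.homologyMap ((alternatingFaceMapComplex C).map (f ▷ Y)) n) := by
    induction n with
    | zero =>
      intro Y hY
      have := hdec Y hY
      exact HomologicalComplex.HomologySequence.mono_homologyMap_τ₃ (tensorDecShortComplexMap f Y)
        (tensorDecShortComplex_shortExact X Y) (tensorDecShortComplex_shortExact X' Y) 0
        (hepi 0 _ (hker Y hY)) inferInstance (fun j hj ↦ by simp at hj)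
    | succ n ih =>
      intro Y hY
      have := hdec Y hY
      refine HomologicalComplex.HomologySequence.mono_homologyMap_τ₃ (tensorDecShortComplexMap f Y)
        (tensorDecShortComplex_shortExact X Y) (tensorDecShortComplex_shortExact X' Y) (n + 1)
        (hepi _ _ (hker Y hY)) inferInstance (fun j hj ↦ ?_)
      obtain rfl : j = n := by simpa using hj
      exact ih _ (hker Y hY)
  rw [quasiIso_iff]
  intro n
  rw [quasiIsoAt_iff_isIso_homologyMap]
  have := hepi n Y hY
  have := hmono n Y hY
  exact isIso_of_mono_of_epi _

end Tensor

end CategoryTheory.SimplicialObject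

/-- Let `A` be a commutative ring and `f : E_• → F_•` a morphism
of simplicial `A`-modules inducing a quasi-isomorphism on the associated
(alternating face map) chain complexes.  Let `L_•` be a simplicial `A`-module with
flat terms.  Then the degreewise tensor product `f ⊗ id : E_• ⊗_A L_• → F_• ⊗_A L_•`
(the whiskering of `f` by `L_•` for the pointwise monoidal structure on simplicial
`A`-modules) also induces a quasi-isomorphism on associated chain complexes. -/
theorem quasiIso_tensor_flat_simplicial_module
    (A : Type u) [CommRing A]
    (E F L : SimplexCategoryᵒᵖ ⥤ ModuleCat.{u} A)
    (f : E ⟶ F)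
    (hL : ∀ n : SimplexCategoryᵒᵖ, Module.Flat A (L.obj n))
    (hf : QuasiIso ((alternatingFaceMapComplex (ModuleCat A)).map f)) :
    QuasiIso ((alternatingFaceMapComplex (ModuleCat A)).map (f ▷ L)) := by
  let P : ObjectProperty (ModuleCat.{u} A) := fun M ↦ Module.Flat A M
  have : P.IsStableUnderRetracts :=
    ⟨fun {M N} r (_ : Module.Flat A N) ↦ Module.Flat.of_retract r.i.hom r.r.hom
      (by rw [← ModuleCat.hom_comp, r.retract]; rfl)⟩
  refine SimplicialObject.quasiIso_whiskerRight P (fun M (_ : Module.Flat A M) ↦ ?_) f L hL hf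
  infer_instance
end

section
/- Let p be a prime, r ≥ 1, and ζ a primitive p^r-th root of unity in an algebraic closure of ℚ_p, so that the ring of integers of ℚ_p(ζ) is ℤ_p[ζ]. The different ideal of ℤ_p[ζ] over ℤ_p is the principal ideal generated by p^r/(ζ^{p^{r−1}} − 1), and the p-adic valuation of this generator (hence of the different) is r − 1/(p−1). -/
open Polynomial

theorem cyclotomic_prime_pow_comp_X_add_one_padicInt_isEisensteinAt (p k : ℕ) [Fact p.Prime] :
    ((cyclotomic (p ^ (k + 1)) ℤ_[p]).comp (X + 1)).IsEisensteinAt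
      (Ideal.span {(p : ℤ_[p])}) := by
  have hp : Prime (p : ℤ_[p]) := PadicInt.prime_p
  have hmap : (cyclotomic (p ^ (k + 1)) ℤ_[p]).comp (X + 1) =
      ((cyclotomic (p ^ (k + 1)) ℤ).comp (X + 1)).map (Int.castRingHom ℤ_[p]) := by
    simp [Polynomial.map_comp]
  have hmonicZ : ((cyclotomic (p ^ (k + 1)) ℤ).comp (X + 1)).Monic := by
    simpa using (cyclotomic.monic (p ^ (k + 1)) ℤ).comp_X_add_C 1
  refine Monic.isEisensteinAt_of_mem_of_notMem (hmap ▸ hmonicZ.map _)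
    ((Ideal.span_singleton_prime hp.ne_zero).2 hp).ne_top (fun {n} hn => ?_) ?_
  · rw [hmap, hmonicZ.natDegree_map] at hn
    have h := (cyclotomic_prime_pow_comp_X_add_one_isEisensteinAt p k).mem hn
    rw [Ideal.submodule_span_eq, Ideal.mem_span_singleton] at h
    rw [hmap, coeff_map, Ideal.mem_span_singleton]
    simpa using map_dvd (Int.castRingHom ℤ_[p]) h
  · have h0 : ((cyclotomic (p ^ (k + 1)) ℤ_[p]).comp (X + 1)).coeff 0 = p := by
      simp [coeff_zero_eq_eval_zero, eval_comp, eval_one_cyclotomic_prime_pow]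
    rw [h0, Ideal.span_singleton_pow, Ideal.mem_span_singleton]
    intro h
    rw [← pow_one (p : ℤ_[p]), ← pow_mul, pow_dvd_pow_iff hp.ne_zero hp.not_isUnit] at h
    omega

theorem irreducible_cyclotomic_prime_pow_padic (p k : ℕ) [Fact p.Prime] :
    Irreducible (cyclotomic (p ^ (k + 1)) ℚ_[p]) := by
  have hp : Prime (p : ℤ_[p]) := PadicInt.prime_p
  have hmonic : ((cyclotomic (p ^ (k + 1)) ℤ_[p]).comp (X + 1)).Monic := by
    simpa using (cyclotomic.monic (p ^ (k + 1)) ℤ_[p]).comp_X_add_C 1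
  have hirr : Irreducible ((cyclotomic (p ^ (k + 1)) ℤ_[p]).comp (X + 1)) := by
    refine (cyclotomic_prime_pow_comp_X_add_one_padicInt_isEisensteinAt p k).irreducible
      ((Ideal.span_singleton_prime hp.ne_zero).2 hp) hmonic.isPrimitive ?_
    rw [natDegree_comp, show (X + 1 : ℤ_[p][X]) = X + C 1 by simp, natDegree_X_add_C, mul_one,
      natDegree_cyclotomic]
    exact Nat.totient_pos.2 (pow_pos (Fact.out : p.Prime).pos _)
  have hirr' : Irreducible (cyclotomic (p ^ (k + 1)) ℤ_[p]) := by
    refine (MulEquiv.irreducible_iff (algEquivAevalXAddC (1 : ℤ_[p]))).1 ?_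
    simpa [comp_eq_aeval] using hirr
  have := ((cyclotomic.monic (p ^ (k + 1))
    ℤ_[p]).irreducible_iff_irreducible_map_fraction_map (K := ℚ_[p])).1 hirr'
  rwa [map_cyclotomic] at this

/-- Integral elements of the `p ^ (k + 1)`-th cyclotomic extension of `ℚ_[p]` lie in `ℤ_[p][ζ]`. -/
theorem mem_adjoin_of_isIntegral_padicInt (p k : ℕ) [Fact p.Prime]
    {L : Type*} [Field L] [Algebra ℚ_[p] L] [Algebra ℤ_[p] L] [IsScalarTower ℤ_[p] ℚ_[p] L]
    [IsCyclotomicExtension {p ^ (k + 1)} ℚ_[p] L]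
    {ζ : L} (hζ : IsPrimitiveRoot ζ (p ^ (k + 1))) {x : L} (hx : IsIntegral ℤ_[p] x) :
    x ∈ Algebra.adjoin ℤ_[p] {ζ} := by
  have hirr := irreducible_cyclotomic_prime_pow_padic p k
  have := IsCyclotomicExtension.finiteDimensional {p ^ (k + 1)} ℚ_[p] L
  have := IsCyclotomicExtension.isSeparable {p ^ (k + 1)} ℚ_[p] L
  have hζint : IsIntegral ℤ_[p] ζ := (hζ.isIntegral (NeZero.pos _)).tower_top
  have hint : IsIntegral ℤ_[p] (hζ.subOnePowerBasis ℚ_[p]).gen := by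
    rw [IsPrimitiveRoot.subOnePowerBasis_gen]
    exact hζint.sub isIntegral_one
  have hle : Algebra.adjoin ℤ_[p] {ζ} = Algebra.adjoin ℤ_[p] {ζ - 1} := by
    refine le_antisymm (Algebra.adjoin_le ?_) (Algebra.adjoin_le ?_) <;>
      rw [Set.singleton_subset_iff, SetLike.mem_coe]
    · simpa using add_mem (Algebra.self_mem_adjoin_singleton ℤ_[p] (ζ - 1)) (one_mem _)
    · exact sub_mem (Algebra.self_mem_adjoin_singleton ℤ_[p] ζ) (one_mem _)
  obtain ⟨u, n, hun⟩ := IsCyclotomicExtension.discr_prime_pow_eq_unit_mul_pow hζ hirr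
  have H := Algebra.discr_mul_isIntegral_mem_adjoin ℚ_[p] (R := ℤ_[p])
    (B := hζ.powerBasis ℚ_[p]) (by simpa using hζint) hx
  rw [hun, IsPrimitiveRoot.powerBasis_gen, hle] at H
  have H' : (p : ℤ_[p]) ^ n • x ∈ Algebra.adjoin ℤ_[p] {ζ - 1} := by
    rw [Algebra.smul_def] at H ⊢
    rcases Int.units_eq_one_or u with rfl | rfl
    · simpa using H
    · simpa using neg_mem H
  have hmin : (minpoly ℤ_[p] (hζ.subOnePowerBasis ℚ_[p]).gen).IsEisensteinAt
      (Submodule.span ℤ_[p] {(p : ℤ_[p])}) := by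
    have h₁ := minpoly.isIntegrallyClosed_eq_field_fractions' ℚ_[p] hint
    rw [IsPrimitiveRoot.subOnePowerBasis_gen] at h₁ ⊢
    rw [hζ.minpoly_sub_one_eq_cyclotomic_comp hirr] at h₁
    have h₂ : minpoly ℤ_[p] (ζ - 1) = (cyclotomic (p ^ (k + 1)) ℤ_[p]).comp (X + 1) := by
      refine map_injective (algebraMap ℤ_[p] ℚ_[p]) (IsFractionRing.injective _ _) ?_
      rw [← h₁]
      simp [Polynomial.map_comp]
    rw [h₂]
    exact cyclotomic_prime_pow_comp_X_add_one_padicInt_isEisensteinAt p k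
  rw [hle, ← IsPrimitiveRoot.subOnePowerBasis_gen (K := ℚ_[p]) hζ]
  exact mem_adjoin_of_smul_prime_pow_smul_of_minpoly_isEisensteinAt (n := n)
    PadicInt.prime_p hint hx (by simpa using H') hmin

theorem aeval_derivative_cyclotomic_prime_pow_mul (p k : ℕ) [Fact p.Prime]
    {R A : Type*} [CommRing R] [CommRing A] [Algebra R A] {z : A}
    (hz : aeval z (cyclotomic (p ^ (k + 1)) R) = 0) :
    aeval z (derivative (cyclotomic (p ^ (k + 1)) R)) * (z ^ p ^ k - 1) =
      (p : A) ^ (k + 1) * z ^ (p ^ (k + 1) - 1) := by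
  have H := congr_arg (fun P => aeval z (derivative P))
    (cyclotomic_prime_pow_mul_X_pow_sub_one R p k)
  simpa [derivative_mul, derivative_X_pow, hz] using H

/-- An additive valuation that is nonnegative on a subring takes the value `1 / (p - 1)` at
`η - 1`, for `η` a primitive `p`-th root of unity, when normalized by `v p = 1`. -/
theorem valuation_primitiveRoot_sub_one (p : ℕ) [Fact p.Prime]
    {O : Type*} [CommRing O] [IsDomain O] {η : O} (hη : IsPrimitiveRoot η p) (hp0 : (p : O) ≠ 0)
    (w : O → ℚ) (hw_mul : ∀ x y : O, x ≠ 0 → y ≠ 0 → w (x * y) = w x + w y)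
    (hw_p : w p = 1) (hw_nonneg : ∀ x : O, x ≠ 0 → 0 ≤ w x) :
    w (η - 1) = 1 / ((p : ℚ) - 1) := by
  have hp : p.Prime := Fact.out
  have hw_one : w 1 = 0 := by simpa using hw_mul 1 1 one_ne_zero one_ne_zero
  have hw_le : ∀ x y : O, y ≠ 0 → x ∣ y → w x ≤ w y := by
    rintro x _ hy ⟨c, rfl⟩
    have hx := left_ne_zero_of_mul hy
    have hc := right_ne_zero_of_mul hy
    rw [hw_mul x c hx hc]
    linarith [hw_nonneg c hc]
  have hw_prod : ∀ (s : Finset ℕ) (f : ℕ → O), (∀ i ∈ s, f i ≠ 0) →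
      w (∏ i ∈ s, f i) = ∑ i ∈ s, w (f i) := by
    classical
    intro s f
    induction s using Finset.induction_on with
    | empty => simp [hw_one]
    | insert a s ha ih =>
      intro h
      rw [Finset.prod_insert ha, Finset.sum_insert ha,
        hw_mul _ _ (h a (by simp)) (Finset.prod_ne_zero_iff.2 fun i hi => h i (by simp [hi])),
        ih fun i hi => h i (by simp [hi])]
  obtain ⟨n, rfl⟩ : ∃ n, p = n + 1 := ⟨p - 1, (Nat.sub_add_cancel hp.one_le).symm⟩
  have hn : (n : ℚ) ≠ 0 := by
    have := hp.two_le
    exact_mod_cast (by omega : n ≠ 0)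
  have hprod := hη.prod_one_sub_pow_eq_order
  have hne : ∀ i ∈ Finset.range n, (1 - η ^ (i + 1)) ≠ 0 := by
    rw [← Finset.prod_ne_zero_iff, hprod]
    exact_mod_cast hp0
  have hη1 : η - 1 ≠ 0 := sub_ne_zero.2 (hη.ne_one hp.one_lt)
  have heq : ∀ i ∈ Finset.range n, w (1 - η ^ (i + 1)) = w (η - 1) := by
    intro i hi
    have hcop : (i + 1).Coprime (n + 1) :=
      (Nat.coprime_of_lt_prime (Nat.succ_ne_zero i) (by simpa using hi) hp).symm
    have ha := hη.associated_sub_one_pow_sub_one_of_coprime hcop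
    refine le_antisymm (hw_le _ _ hη1 ?_) (hw_le _ _ (hne i hi) ?_)
    · rw [← neg_sub, neg_dvd]
      exact ha.symm.dvd
    · rw [← neg_sub (η ^ (i + 1)), dvd_neg]
      exact ha.dvd
  have hsum := hw_prod _ _ hne
  rw [hprod, Finset.sum_congr rfl heq, Finset.sum_const, Finset.card_range, nsmul_eq_mul,
    ← Nat.cast_succ, hw_p] at hsum
  rw [Nat.cast_succ, add_sub_cancel_right, eq_div_iff hn]
  linarith


/-- Let `p` be a prime, `r ≥ 1`, and `ζ` a primitive `p^r`-th root
of unity generating `L = ℚ_p(ζ)` over `ℚ_p`, with ring of integers `O = ℤ_p[ζ]`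
(the integral closure of `ℤ_p` in `L`).  Then the different ideal of `O` over `ℤ_p`
is the principal ideal generated by `p^r/(ζ^{p^{r-1}} - 1)`, and the `p`-adic
valuation of this generator is `r - 1/(p-1)`.  The valuation `v` is axiomatized as
the unique `ℚ`-valued valuation on `L` with `v(p) = 1` which is nonnegative on
integral elements. -/
theorem differentIdeal_cyclotomic_eq_span_and_valuation
    (p r : ℕ) [Fact p.Prime] (hr : 1 ≤ r)
    (L : Type*) [Field L] [Algebra ℚ_[p] L]
    [Algebra ℤ_[p] L] [IsScalarTower ℤ_[p] ℚ_[p] L]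
    (ζ : L) (hζ : IsPrimitiveRoot ζ (p ^ r))
    (hgen : Algebra.adjoin ℚ_[p] {ζ} = ⊤)
    (O : Type*) [CommRing O] [Algebra ℤ_[p] O] [Algebra O L]
    [IsScalarTower ℤ_[p] O L] [IsIntegralClosure O ℤ_[p] L]
    [IsDedekindDomain O] [NoZeroSMulDivisors ℤ_[p] O]
    (v : L → ℚ)
    (hv_mul : ∀ x y : L, x ≠ 0 → y ≠ 0 → v (x * y) = v x + v y)
    (hv_add : ∀ x y : L, x ≠ 0 → y ≠ 0 → x + y ≠ 0 → min (v x) (v y) ≤ v (x + y))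
    (hv_p : v ((p : ℕ) : L) = 1)
    (hv_int : ∀ x : O, x ≠ 0 → 0 ≤ v (algebraMap O L x)) :
    ∃ d : O, algebraMap O L d * (ζ ^ p ^ (r - 1) - 1) = (p : L) ^ r ∧
      differentIdeal ℤ_[p] O = Ideal.span {d} ∧
      v (algebraMap O L d) = (r : ℚ) - 1 / ((p : ℚ) - 1) := by
  obtain ⟨k, rfl⟩ : ∃ k, r = k + 1 := ⟨r - 1, (Nat.sub_add_cancel hr).symm⟩
  rw [Nat.add_sub_cancel]
  have hirr := irreducible_cyclotomic_prime_pow_padic p k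
  have hcyc : IsCyclotomicExtension {p ^ (k + 1)} ℚ_[p] L := by
    refine (IsCyclotomicExtension.iff_singleton _ _ _).2 ⟨⟨ζ, hζ⟩, fun x => ?_⟩
    have hx : x ∈ Algebra.adjoin ℚ_[p] {ζ} := hgen ▸ Algebra.mem_top
    exact Algebra.adjoin_mono (by simpa using hζ.pow_eq_one) hx
  have := IsCyclotomicExtension.finiteDimensional {p ^ (k + 1)} ℚ_[p] L
  have := IsCyclotomicExtension.isSeparable {p ^ (k + 1)} ℚ_[p] L
  have hinj : Function.Injective (algebraMap O L) :=
    IsIntegralClosure.algebraMap_injective O ℤ_[p] L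
  have hζint : IsIntegral ℤ_[p] ζ := (hζ.isIntegral (NeZero.pos _)).tower_top
  obtain ⟨z, rfl⟩ := (IsIntegralClosure.isIntegral_iff (A := O)).1 hζint
  have hz : IsPrimitiveRoot z (p ^ (k + 1)) := hζ.of_map_of_injective hinj
  have hzint : IsIntegral ℤ_[p] z := IsIntegralClosure.isIntegral ℤ_[p] L z
  have hmin : minpoly ℤ_[p] z = cyclotomic (p ^ (k + 1)) ℤ_[p] := by
    refine map_injective (algebraMap ℤ_[p] ℚ_[p]) (IsFractionRing.injective _ _) ?_
    rw [← minpoly.isIntegrallyClosed_eq_field_fractions ℚ_[p] L hzint, map_cyclotomic,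
      hζ.minpoly_eq_cyclotomic_of_irreducible hirr]
  have htop : Algebra.adjoin ℤ_[p] {z} = ⊤ := by
    refine Algebra.eq_top_iff.2 fun x => ?_
    have hx := mem_adjoin_of_isIntegral_padicInt p k hζ
      ((IsIntegralClosure.isIntegral ℤ_[p] L x).algebraMap (B := L))
    rw [← IsScalarTower.toAlgHom_apply ℤ_[p] O L z, ← AlgHom.map_adjoin_singleton] at hx
    obtain ⟨y, hy, hyx⟩ := hx
    rwa [← hinj hyx]
  have hdiff := conductor_mul_differentIdeal ℤ_[p] ℚ_[p] L z hgen
  rw [conductor_eq_top_of_adjoin_eq_top htop, Ideal.top_mul, hmin] at hdiff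
  have hzu : IsUnit z := hz.isUnit (NeZero.ne _)
  have hdmul : z * aeval z (derivative (cyclotomic (p ^ (k + 1)) ℤ_[p])) * (z ^ p ^ k - 1) =
      (p : O) ^ (k + 1) := by
    rw [mul_assoc, aeval_derivative_cyclotomic_prime_pow_mul p k (hmin ▸ minpoly.aeval _ _),
      mul_left_comm, mul_pow_sub_one (NeZero.ne _), hz.pow_eq_one, mul_one]
  set d := z * aeval z (derivative (cyclotomic (p ^ (k + 1)) ℤ_[p])) with hd
  have hp0 : (p : O) ≠ 0 := by
    intro h
    have hL : (p : L) = 0 := by simpa using congr_arg (algebraMap O L) h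
    have hQ : algebraMap ℚ_[p] L p = algebraMap ℚ_[p] L 0 := by simpa using hL
    exact NeZero.ne (p : ℚ_[p]) (by exact_mod_cast (algebraMap ℚ_[p] L).injective hQ)
  have hne : d * (z ^ p ^ k - 1) ≠ 0 := hdmul ▸ pow_ne_zero _ hp0
  let w : O → ℚ := fun x => v (algebraMap O L x)
  have hw_mul : ∀ x y : O, x ≠ 0 → y ≠ 0 → w (x * y) = w x + w y := fun x y hx hy => by
    simp only [w, map_mul]
    exact hv_mul _ _ ((map_ne_zero_iff _ hinj).2 hx) ((map_ne_zero_iff _ hinj).2 hy)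
  have hw_p : w p = 1 := by simpa [w] using hv_p
  have hw_pow : ∀ n : ℕ, w ((p : O) ^ (n + 1)) = n + 1 := by
    intro n
    induction n with
    | zero => simp [hw_p]
    | succ n ih => rw [pow_succ, hw_mul _ _ (pow_ne_zero _ hp0) hp0, ih, hw_p]; push_cast; ring
  refine ⟨d, ?_, ?_, ?_⟩
  · simpa using congr_arg (algebraMap O L) hdmul
  · rw [hdiff, hd, Ideal.span_singleton_mul_left_unit hzu]
  · have hη : IsPrimitiveRoot (z ^ p ^ k) p :=
      hz.pow (NeZero.pos _) (pow_succ p k)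
    have hπ := valuation_primitiveRoot_sub_one p hη hp0 w hw_mul hw_p hv_int
    have hsum := hw_mul d _ (left_ne_zero_of_mul hne) (right_ne_zero_of_mul hne)
    rw [hdmul, hw_pow, hπ] at hsum
    change w d = _
    push_cast
    linarith
end
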